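/- If Even wins the parity game (G,v) and |V| < 2^r, then Even wins the r-register game R^r(G,v,x) for every initial register content x ∈ ℕ^r. Consequently (with the converse for Odd), for n < 2^r the games (G,v) and R^r(G,v,x) have the same winner. -/

import Mathlib

/-- A (finite or infinite) path in the graph with edge relation `E`:
`f k = some u` means the `k`-th position is `u`; once `none`, always `none`. -/
structure Play (V : Type) (E : V → V → Prop) where
  f : ℕ → Option V
  first : (f 0).isSome
  closed : ∀ k, f k = none → f (k + 1) = none
  step : ∀ k u v, f k = some u → f (k + 1) = some v → E u v

/-- A play is maximal if it is infinite or ends in a sink. -/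
def Play.IsMax {V : Type} {E : V → V → Prop} (α : Play V E) : Prop :=
  (∀ k, α.f k ≠ none) ∨
    ∃ n u, α.f n = some u ∧ α.f (n + 1) = none ∧ ∀ w, ¬ E u w

/-- A positional strategy for the player owning the vertices `Vi`,
with support `W`: a partial map only defined on `W ∩ Vi`, suggesting
legal moves staying in `W`. -/
structure PStrategy {V : Type} (E : V → V → Prop) (Vi : Set V) where
  W : Set V
  σ : V → Option V
  dom : ∀ w v, σ w = some v → w ∈ W ∧ w ∈ Vi ∧ E w v ∧ v ∈ W

/-- A play follows a positional strategy if, whenever the strategy is defined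
at the current position and the play continues, the next position is the
strategy's suggestion. -/
def Play.Follows {V : Type} {E : V → V → Prop} {Vi : Set V} (α : Play V E)
    (s : PStrategy E Vi) : Prop :=
  ∀ k u v, α.f k = some u → s.σ u = some v → α.f (k + 1) ≠ none → α.f (k + 1) = some v

/-- `s` is a winning strategy (an `i`-strategy) w.r.t. the set of games `C`
and the winning condition `Ci ⊆ C`: every game starting in the support and
following `s` is won. -/
def PStrategy.Winning {V : Type} {E : V → V → Prop} {Vi : Set V}
    (C Ci : Set (Play V E)) (s : PStrategy E Vi) : Prop :=
  ∀ α ∈ C, (∃ u, α.f 0 = some u ∧ u ∈ s.W) → α.Follows s → α ∈ Ci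

/-- Order on strategies: larger support and larger graph of the partial map. -/
def PStrategy.le {V : Type} {E : V → V → Prop} {Vi : Set V}
    (s t : PStrategy E Vi) : Prop :=
  s.W ⊆ t.W ∧ ∀ w v, s.σ w = some v → t.σ w = some v

/-- A maximal winning strategy. -/
def PStrategy.MaxWinning {V : Type} {E : V → V → Prop} {Vi : Set V}
    (C Ci : Set (Play V E)) (s : PStrategy E Vi) : Prop :=
  s.Winning C Ci ∧ ∀ t : PStrategy E Vi, t.Winning C Ci → s.le t → t.le s

/-- The color `c` occurs infinitely often along the play `α`. -/
def InfOcc {V : Type} {E : V → V → Prop} (χ : V → ℕ) (α : Play V E) (c : ℕ) : Prop :=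
  ∀ N, ∃ k, N ≤ k ∧ ∃ u, α.f k = some u ∧ χ u = c

/-- The parity winning condition for the player of parity `par` whose opponent
owns the vertices in `oppSet`: win finite games ending in a sink of the opponent,
and infinite games whose largest infinitely-occurring color has parity `par`. -/
def ParityWinsFor {V : Type} {E : V → V → Prop} (χ : V → ℕ) (oppSet : Set V)
    (par : ℕ) (α : Play V E) : Prop :=
  (∃ n u, α.f n = some u ∧ α.f (n + 1) = none ∧ u ∈ oppSet) ∨
  ((∀ k, α.f k ≠ none) ∧
    ∃ c, InfOcc χ α c ∧ c % 2 = par ∧ ∀ c', InfOcc χ α c' → c' ≤ c)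

/-- The set of games won by the player of parity `par` (opponent owns `oppSet`). -/
def ParityWinSet {V : Type} (E : V → V → Prop) (χ : V → ℕ) (oppSet : Set V)
    (par : ℕ) : Set (Play V E) :=
  {α | α.IsMax ∧ ParityWinsFor χ oppSet par α}

/-- The player owning `Vi` wins the game at position `v`:
there is a positional winning strategy whose support contains `v`. -/
def WinsAt {V : Type} (E : V → V → Prop) (Vi : Set V)
    (C Ci : Set (Play V E)) (v : V) : Prop :=
  ∃ s : PStrategy E Vi, s.Winning C Ci ∧ v ∈ s.W

/-- Register contents after `reset(j)`: remove register `j`, insert a `0`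
at the bottom (registers are kept sorted in increasing order). -/
def resetReg {r : ℕ} (x : Fin r → ℕ) (j : Fin r) : Fin r → ℕ :=
  fun k => if k.val = 0 then 0
    else if k.val ≤ j.val then x ⟨k.val - 1, lt_of_le_of_lt (Nat.sub_le _ _) k.isLt⟩
    else x k

/-- The color of the edge `reset(j)` (registers are numbered `1,…,r`,
so register `j : Fin r` is register `j+1`): `2(j+1)` if the reset register's
content is even, `2(j+1)+1` if it is odd. -/
def resetColor {r : ℕ} (x : Fin r → ℕ) (j : Fin r) : ℕ :=
  if x j % 2 = 0 then 2 * (j.val + 1) else 2 * (j.val + 1) + 1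

/-- States of the `r`-register graph `R^r(G)`: `(v, x, none)` is the reset
state `(v,x,s)`; `(v, x, some c)` is the transition state `(v,x,t)` reached
via a reset edge of color `c` (recording the edge color in the state encodes
the edge-colored parity game as a state-colored one; transitions have color 0). -/
def RE {V : Type} (E : V → V → Prop) (χ : V → ℕ) (r : ℕ) :
    (V × (Fin r → ℕ) × Option ℕ) → (V × (Fin r → ℕ) × Option ℕ) → Prop :=
  fun p q =>
    (∃ j : Fin r, p.2.2 = none ∧
      q = (p.1, resetReg p.2.1 j, some (resetColor p.2.1 j))) ∨
    (∃ c, p.2.2 = some c ∧ q.2.2 = none ∧ E p.1 q.1 ∧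
      q.2.1 = fun i => max (χ q.1) (p.2.1 i))

/-- Color of a state of the register graph: the color of the incoming reset
edge for transition states, `0` for reset states (= color of transition edges). -/
def rcol {V : Type} {r : ℕ} : (V × (Fin r → ℕ) × Option ℕ) → ℕ :=
  fun p => p.2.2.getD 0

/-- States of the register graph belonging to Even: all reset states, and the
transition states whose underlying vertex belongs to Even. -/
def REvenStates {V : Type} (V0 : Set V) (r : ℕ) :
    Set (V × (Fin r → ℕ) × Option ℕ) :=
  {p | p.2.2 = none ∨ p.1 ∈ V0}

/-- States of the register graph belonging to Odd: the transition states whose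
underlying vertex belongs to Odd. -/
def ROddStates {V : Type} (V1 : Set V) (r : ℕ) :
    Set (V × (Fin r → ℕ) × Option ℕ) :=
  {p | p.2.2 ≠ none ∧ p.1 ∈ V1}

open Relation

section ResetStrategies

/-- Register contents, indexed by `ℕ`, after the reset of register `j`. -/
def shiftReset (j : ℕ) (x : ℕ → ℕ) : ℕ → ℕ :=
  fun k => if k = 0 then 0 else if k ≤ j then x (k - 1) else x k

/-- An odd register value exceeding the bound `d`. -/
def Junk (d a : ℕ) : Prop := a % 2 = 1 ∧ d < a

/-- `y` agrees on the first `r` registers with the contents obtained from `x` by resetting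
register `j` and moving to a vertex of color `c`. -/
def RegStep (r j c : ℕ) (x y : ℕ → ℕ) : Prop :=
  ∀ k < r, y k = max c (shiftReset j x k)

lemma shiftReset_of_lt {j k : ℕ} (h : j < k) (x : ℕ → ℕ) : shiftReset j x k = x k := by
  unfold shiftReset
  rw [if_neg (by omega), if_neg (by omega)]

lemma shiftReset_zero (j : ℕ) (x : ℕ → ℕ) : shiftReset j x 0 = 0 := by
  simp [shiftReset]

lemma shiftReset_succ_self (s : ℕ) (x : ℕ → ℕ) : shiftReset (s + 1) x (s + 1) = x s := by
  simp [shiftReset]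

lemma not_junk_max {d c a : ℕ} (hc : c ≤ d) (ha : ¬ Junk d a) : ¬ Junk d (max c a) := by
  unfold Junk at *
  rcases le_total c a with h | h
  · rwa [max_eq_right h]
  · rw [max_eq_left h]; omega

/-- The set of the first `r` registers that hold junk. -/
noncomputable def junkSet (d r : ℕ) (x : ℕ → ℕ) : Finset ℕ :=
  open Classical in (Finset.range r).filter fun k => Junk d (x k)

lemma mem_junkSet {d r k : ℕ} {x : ℕ → ℕ} : k ∈ junkSet d r x ↔ k < r ∧ Junk d (x k) := by
  simp [junkSet]

lemma card_junkSet_le {d r j c : ℕ} {x y : ℕ → ℕ} (hj : j < r) (hc : c ≤ d)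
    (h : RegStep r j c x y) : (junkSet d r y).card ≤ ((junkSet d r x).erase j).card := by
  have key : ∀ k ∈ junkSet d r y, Junk d (shiftReset j x k) := by
    intro k hk
    have hk' := mem_junkSet.1 hk
    rw [h k hk'.1] at hk'
    by_contra hn
    exact not_junk_max hc hn hk'.2
  have hpos : ∀ k ∈ junkSet d r y, k ≠ 0 := by
    rintro k hk rfl
    have := key 0 hk
    simp [shiftReset_zero, Junk] at this
  refine Finset.card_le_card_of_injOn (fun k => if k ≤ j then k - 1 else k) ?_ ?_
  · intro k hk
    have h1 := key k hk
    have h2 := hpos k hk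
    have h3 := (mem_junkSet.1 hk).1
    simp only [shiftReset, if_neg h2] at h1
    simp only [Finset.coe_erase, Set.mem_sdiff, Finset.mem_coe, mem_junkSet,
      Set.mem_singleton_iff]
    split_ifs at h1 ⊢ with h4
    · exact ⟨⟨by omega, h1⟩, by omega⟩
    · exact ⟨⟨by omega, h1⟩, by omega⟩
  · intro a ha b hb hab
    have h1 := hpos a ha
    have h2 := hpos b hb
    simp only at hab
    split_ifs at hab <;> omega

/-- `ρ` is a reset strategy on `S` using `r` registers which is winning for Even from every
register content, and defensive, as witnessed by the invariant `Inv`, as soon as the top register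
holds an even value of at least `d`. -/
structure DefensiveOn {V : Type} (H : V → V → Prop) (χ : V → ℕ) (S : Finset V) (d r : ℕ)
    (ρ : V → (ℕ → ℕ) → ℕ) (Inv : V → (ℕ → ℕ) → Prop) : Prop where
  lt : ∀ u ∈ S, ∀ x, ρ u x < r
  entry : ∀ u ∈ S, ∀ x, (∀ k < r, χ u ≤ x k) → x (r - 1) % 2 = 0 → d ≤ x (r - 1) → Inv u x
  not_junk : ∀ u ∈ S, ∀ x, Inv u x → ¬ Junk d (x (r - 1))
  even : ∀ u ∈ S, ∀ x, Inv u x → ρ u x = r - 1 → x (r - 1) % 2 = 0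
  not_junk_reset : ∀ u ∈ S, ∀ x, Inv u x → ¬ Junk d (shiftReset (ρ u x) x (r - 1))
  preserve : ∀ u ∈ S, ∀ v ∈ S, H u v → ∀ x y, Inv u x → RegStep r (ρ u x) (χ v) x y → Inv v y
  win : ∀ (u : ℕ → V) (x : ℕ → ℕ → ℕ), (∀ n, u n ∈ S) → (∀ n, H (u n) (u (n + 1))) →
    (∀ n, RegStep r (ρ (u n) (x n)) (χ (u (n + 1))) (x n) (x (n + 1))) →
    ∃ j < r, (∀ N, ∃ n ≥ N, ρ (u n) (x n) = j) ∧
      ∃ N, ∀ n ≥ N, ρ (u n) (x n) ≤ j ∧ (ρ (u n) (x n) = j → x n j % 2 = 0)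

lemma defensiveOn_empty {V : Type} (H : V → V → Prop) (χ : V → ℕ) (d r : ℕ) :
    DefensiveOn H χ ∅ d r (fun _ _ => 0) (fun _ _ => True) where
  lt := by simp
  entry := by simp
  not_junk := by simp
  even := by simp
  not_junk_reset := by simp
  preserve := by simp
  win := by simp

lemma exists_eventually_const_of_antitone {f : ℕ → ℕ} {N : ℕ}
    (h : ∀ n ≥ N, f (n + 1) ≤ f n) : ∃ M ≥ N, ∀ n ≥ M, f n = f M := by
  classical
  have hex : ∃ c, ∃ n ≥ N, f n = c := ⟨_, N, le_rfl, rfl⟩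
  obtain ⟨M, hMN, hM⟩ := Nat.find_spec hex
  refine ⟨M, hMN, fun n hn => ?_⟩
  induction n, hn using Nat.le_induction with
  | base => rfl
  | succ n hn ih =>
    have h1 := h n (by omega)
    have h2 := Nat.find_min' hex ⟨n + 1, by omega, rfl⟩
    omega

variable {V : Type} {H : V → V → Prop} {χ : V → ℕ}

/-- The induction step: strategies on the layers of the vertices of color at most `d - 2` are
combined to a strategy on `S`. -/
lemma exists_defensiveOn_of_layers {S : Finset V} {d s : ℕ} (hd : d % 2 = 0)
    (hcard : S.card < 2 ^ (s + 1)) (hcol : ∀ u ∈ S, χ u ≤ d) (lev : V → ℕ)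
    (hlev : ∀ u ∈ S, ∀ v ∈ S, H u v → χ u ≠ d → χ v ≠ d → lev v ≤ lev u)
    (hlev' : ∀ u ∈ S, ∀ v ∈ S, H u v → χ u + 1 = d → χ v ≠ d → lev v < lev u)
    (T : ℕ → Finset V) (hT : ∀ l u, u ∈ T l ↔ u ∈ S ∧ χ u + 2 ≤ d ∧ lev u = l)
    (hsub : ∀ l r, (T l).card < 2 ^ r → ∃ ρ Inv, DefensiveOn H χ (T l) (d - 2) r ρ Inv) :
    ∃ ρ Inv, DefensiveOn H χ S d (s + 1) ρ Inv := by
  classical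
  set Large : ℕ → Prop := fun l => 2 ^ s ≤ (T l).card with hLarge
  have hTS : ∀ l, T l ⊆ S := fun l u hu => ((hT l u).1 hu).1
  have hlarge_unique : ∀ l l', Large l → Large l' → l = l' := by
    intro l l' hl hl'
    by_contra hne
    have hdis : Disjoint (T l) (T l') := Finset.disjoint_left.2 fun u hu hu' =>
      hne (((hT l u).1 hu).2.2.symm.trans ((hT l' u).1 hu').2.2)
    have := Finset.card_le_card (Finset.union_subset (hTS l) (hTS l'))
    rw [Finset.card_union_of_disjoint hdis] at this
    simp only [hLarge] at hl hl'
    rw [pow_succ] at hcard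
    omega
  have hlarge_mem : ∀ l, Large l → ∃ w, w ∈ T l := fun l hl =>
    Finset.card_pos.1 (lt_of_lt_of_le (by positivity) hl)
  have hs_pos : ∀ u ∈ S, ∀ v ∈ S, u ≠ v → 1 ≤ s := by
    intro u hu v hv huv
    by_contra hs
    obtain rfl : s = 0 := by omega
    have : 1 < S.card := Finset.one_lt_card.2 ⟨u, hu, v, hv, huv⟩
    omega
  have hex : ∀ l, ∃ ρ Inv,
      DefensiveOn H χ (T l) (d - 2) (if Large l then s + 1 else s) ρ Inv := by
    intro l
    refine hsub l _ ?_
    split_ifs with h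
    · exact lt_of_le_of_lt (Finset.card_le_card (hTS l)) hcard
    · simpa [hLarge] using h
  choose ρ' Inv' hρ' using hex
  have hbig : ∀ l, Large l → DefensiveOn H χ (T l) (d - 2) (s + 1) (ρ' l) (Inv' l) := by
    intro l hl
    have := hρ' l
    simpa only [hl, if_true, if_false] using this
  have hsmall : ∀ l, ¬ Large l → DefensiveOn H χ (T l) (d - 2) s (ρ' l) (Inv' l) := by
    intro l hl
    have := hρ' l
    simpa only [hl, if_true, if_false] using this
  -- the combined strategy
  let ρ : V → (ℕ → ℕ) → ℕ := fun u x =>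
    if χ u = d then (if h : ∃ k, k < s + 1 ∧ Junk d (x k) then h.choose else s)
    else if χ u + 1 = d then 0
    else ρ' (lev u) u x
  let Inv : V → (ℕ → ℕ) → Prop := fun u x =>
    if χ u = d then ¬ Junk d (x s) ∧ ∀ k < s + 1, d ≤ x k
    else if u ∈ T (lev u) ∧ Large (lev u) then Inv' (lev u) u x
    else if ∃ L, Large L ∧ lev u ≤ L then ¬ Junk d (x s)
    else x s % 2 = 0 ∧ d ≤ x s
  have hmemT : ∀ u ∈ S, χ u ≠ d → χ u + 1 ≠ d → u ∈ T (lev u) := fun u hu h1 h2 =>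
    (hT _ _).2 ⟨hu, by have := hcol u hu; omega, rfl⟩
  have hρ_top_junk : ∀ u x, χ u = d → (h : ∃ k, k < s + 1 ∧ Junk d (x k)) →
      ρ u x < s + 1 ∧ Junk d (x (ρ u x)) := by
    intro u x hu h
    have : ρ u x = h.choose := by simp only [ρ, if_pos hu, dif_pos h]
    rw [this]; exact h.choose_spec
  have hρ_top : ∀ u x, χ u = d → (¬ ∃ k, k < s + 1 ∧ Junk d (x k)) → ρ u x = s := by
    intro u x hu h
    simp only [ρ, if_pos hu, dif_neg h]
  have hρ_odd : ∀ u x, χ u + 1 = d → ρ u x = 0 := by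
    intro u x hu
    simp only [ρ, if_neg (show χ u ≠ d by omega), if_pos hu]
  have hρ_low : ∀ u x, u ∈ T (lev u) → ρ u x = ρ' (lev u) u x := by
    intro u x hu
    have := ((hT _ _).1 hu).2.1
    simp only [ρ, if_neg (show χ u ≠ d by omega), if_neg (show χ u + 1 ≠ d by omega)]
  have hlt : ∀ u ∈ S, ∀ x, ρ u x < s + 1 := by
    intro u hu x
    by_cases h1 : χ u = d
    · by_cases h : ∃ k, k < s + 1 ∧ Junk d (x k)
      · exact (hρ_top_junk u x h1 h).1
      · rw [hρ_top u x h1 h]; omega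
    by_cases h2 : χ u + 1 = d
    · rw [hρ_odd u x h2]; omega
    have hm := hmemT u hu h1 h2
    rw [hρ_low u x hm]
    by_cases hl : Large (lev u)
    · exact (hbig _ hl).lt u hm x
    · have := (hsmall _ hl).lt u hm x; omega
  -- outside the color `d` and the large layer, the top register is only reset if it is the only one
  have hρ_small : ∀ u ∈ S, χ u ≠ d → ¬ (u ∈ T (lev u) ∧ Large (lev u)) → ∀ x, ρ u x < s ∨
      (s = 0 ∧ χ u + 1 = d ∧ ¬ ∃ L, Large L) := by
    intro u hu h1 h2 x
    by_cases h3 : χ u + 1 = d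
    · rcases Nat.eq_zero_or_pos s with hs | hs
      · refine Or.inr ⟨hs, h3, ?_⟩
        rintro ⟨L, hL⟩
        obtain ⟨w, hw⟩ := hlarge_mem L hL
        have := hs_pos u hu w (hTS _ hw) (by
          rintro rfl
          have := ((hT _ _).1 hw).2.1
          omega)
        omega
      · left; rw [hρ_odd u x h3]; exact hs
    · have hm := hmemT u hu h1 h3
      left
      rw [hρ_low u x hm]
      exact (hsmall _ fun h => h2 ⟨hm, h⟩).lt u hm x
  have hInv_top : ∀ u x, χ u = d → (Inv u x ↔ ¬ Junk d (x s) ∧ ∀ k < s + 1, d ≤ x k) := by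
    intro u x h; simp only [Inv, if_pos h]
  have hInv_big : ∀ u x, χ u ≠ d → u ∈ T (lev u) ∧ Large (lev u) →
      (Inv u x ↔ Inv' (lev u) u x) := by
    intro u x h h'; simp only [Inv, if_neg h, if_pos h']
  have hInv_after : ∀ u x, χ u ≠ d → ¬ (u ∈ T (lev u) ∧ Large (lev u)) →
      (∃ L, Large L ∧ lev u ≤ L) → (Inv u x ↔ ¬ Junk d (x s)) := by
    intro u x h h' h''; simp only [Inv, if_neg h, if_neg h', if_pos h'']
  have hInv_before : ∀ u x, χ u ≠ d → ¬ (u ∈ T (lev u) ∧ Large (lev u)) →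
      (¬ ∃ L, Large L ∧ lev u ≤ L) → (Inv u x ↔ x s % 2 = 0 ∧ d ≤ x s) := by
    intro u x h h' h''; simp only [Inv, if_neg h, if_neg h', if_neg h'']
  have hentry : ∀ u ∈ S, ∀ x, (∀ k < s + 1, χ u ≤ x k) → x s % 2 = 0 → d ≤ x s → Inv u x := by
    intro u hu x hlb he hge
    have hnj : ¬ Junk d (x s) := by unfold Junk; omega
    by_cases h1 : χ u = d
    · rw [hInv_top u x h1]; exact ⟨hnj, fun k hk => h1 ▸ hlb k hk⟩
    by_cases h2 : u ∈ T (lev u) ∧ Large (lev u)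
    · rw [hInv_big u x h1 h2]
      exact (hbig _ h2.2).entry u h2.1 x hlb he (by simp only [Nat.add_sub_cancel]; omega)
    by_cases h3 : ∃ L, Large L ∧ lev u ≤ L
    · rwa [hInv_after u x h1 h2 h3]
    · rw [hInv_before u x h1 h2 h3]; exact ⟨he, hge⟩
  have hnot_junk : ∀ u ∈ S, ∀ x, Inv u x → ¬ Junk d (x s) := by
    intro u hu x hI
    by_cases h1 : χ u = d
    · exact ((hInv_top u x h1).1 hI).1
    by_cases h2 : u ∈ T (lev u) ∧ Large (lev u)
    · have := (hbig _ h2.2).not_junk u h2.1 x ((hInv_big u x h1 h2).1 hI)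
      simp only [Junk, Nat.add_sub_cancel] at this ⊢
      omega
    by_cases h3 : ∃ L, Large L ∧ lev u ≤ L
    · exact (hInv_after u x h1 h2 h3).1 hI
    · have := (hInv_before u x h1 h2 h3).1 hI
      unfold Junk; omega
  have heven_top : ∀ u x, χ u = d → Inv u x → x s % 2 = 0 ∧ d ≤ x s := by
    intro u x h1 hI
    obtain ⟨ha, hb⟩ := (hInv_top u x h1).1 hI
    have := hb s (by omega)
    unfold Junk at ha
    omega
  have heven : ∀ u ∈ S, ∀ x, Inv u x → ρ u x = s → x s % 2 = 0 := by
    intro u hu x hI hr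
    by_cases h1 : χ u = d
    · exact (heven_top u x h1 hI).1
    by_cases h2 : u ∈ T (lev u) ∧ Large (lev u)
    · rw [hρ_low u x h2.1] at hr
      exact (hbig _ h2.2).even u h2.1 x ((hInv_big u x h1 h2).1 hI) hr
    rcases hρ_small u hu h1 h2 x with h | ⟨-, -, h⟩
    · omega
    · exact ((hInv_before u x h1 h2 (fun ⟨L, hL, _⟩ => h ⟨L, hL⟩)).1 hI).1
  have hreset_top : ∀ u x, χ u = d → Inv u x → ¬ Junk d (shiftReset (ρ u x) x s) ∧
      (1 ≤ s → shiftReset (ρ u x) x s % 2 = 0 ∧ d ≤ shiftReset (ρ u x) x s) := by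
    intro u x h1 hI
    obtain ⟨ha, hb⟩ := (hInv_top u x h1).1 hI
    have hev := heven_top u x h1 hI
    by_cases h : ∃ k, k < s + 1 ∧ Junk d (x k)
    · obtain ⟨h2, h3⟩ := hρ_top_junk u x h1 h
      have : ρ u x ≠ s := fun h => ha (h ▸ h3)
      rw [shiftReset_of_lt (by omega)]
      exact ⟨ha, fun _ => hev⟩
    · rw [hρ_top u x h1 h]
      rcases s with - | s
      · rw [shiftReset_zero]; simp [Junk]
      · rw [shiftReset_succ_self]
        have h2 : ¬ Junk d (x s) := fun hj => h ⟨s, by omega, hj⟩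
        have h3 := hb s (by omega)
        refine ⟨h2, fun _ => ?_⟩
        unfold Junk at h2
        omega
  have hnot_junk_reset : ∀ u ∈ S, ∀ x, Inv u x → ¬ Junk d (shiftReset (ρ u x) x s) := by
    intro u hu x hI
    by_cases h1 : χ u = d
    · exact (hreset_top u x h1 hI).1
    by_cases h2 : u ∈ T (lev u) ∧ Large (lev u)
    · have := (hbig _ h2.2).not_junk_reset u h2.1 x ((hInv_big u x h1 h2).1 hI)
      rw [hρ_low u x h2.1]
      simp only [Junk, Nat.add_sub_cancel] at this ⊢
      omega
    rcases hρ_small u hu h1 h2 x with h | ⟨rfl, -, -⟩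
    · rw [shiftReset_of_lt h]; exact hnot_junk u hu x hI
    · rw [shiftReset_zero]; simp [Junk]
  have hpreserve : ∀ u ∈ S, ∀ v ∈ S, H u v → ∀ x y, Inv u x →
      RegStep (s + 1) (ρ u x) (χ v) x y → Inv v y := by
    intro u hu v hv huv x y hI hxy
    have hlb : ∀ k < s + 1, χ v ≤ y k := fun k hk => by rw [hxy k hk]; exact le_max_left _ _
    have hys := hxy s (by omega)
    have hnjy : ¬ Junk d (y s) := by
      rw [hys]; exact not_junk_max (hcol v hv) (hnot_junk_reset u hu x hI)
    by_cases hv1 : χ v = d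
    · rw [hInv_top v y hv1]; exact ⟨hnjy, fun k hk => hv1 ▸ hlb k hk⟩
    have hgood : shiftReset (ρ u x) x s % 2 = 0 ∧ d ≤ shiftReset (ρ u x) x s → Inv v y := by
      rintro ⟨h1, h2⟩
      rw [max_eq_right ((hcol v hv).trans h2)] at hys
      exact hentry v hv y hlb (by rw [hys]; exact h1) (by rw [hys]; exact h2)
    by_cases h1 : χ u = d
    · refine hgood ((hreset_top u x h1 hI).2 ?_)
      exact hs_pos u hu v hv (by rintro rfl; exact hv1 h1)
    have hlv := hlev u hu v hv huv h1 hv1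
    by_cases h2 : u ∈ T (lev u) ∧ Large (lev u)
    · by_cases hv2 : v ∈ T (lev u)
      · have hvl : lev v = lev u := ((hT _ _).1 hv2).2.2
        rw [hInv_big v y hv1 (by rw [hvl]; exact ⟨hv2, h2.2⟩), hvl]
        refine (hbig _ h2.2).preserve u h2.1 v hv2 huv x y ((hInv_big u x h1 h2).1 hI) ?_
        rwa [← hρ_low u x h2.1]
      · have hv3 : ¬ (v ∈ T (lev v) ∧ Large (lev v)) := by
          rintro ⟨ha, hb⟩
          rw [hlarge_unique _ _ hb h2.2] at ha
          exact hv2 ha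
        rwa [hInv_after v y hv1 hv3 ⟨_, h2.2, hlv⟩]
    by_cases h3 : ∃ L, Large L ∧ lev u ≤ L
    · obtain ⟨L, hL, hle⟩ := h3
      have hv3 : ¬ (v ∈ T (lev v) ∧ Large (lev v)) := by
        rintro ⟨ha, hb⟩
        have hvL := hlarge_unique _ _ hb hL
        by_cases hu2 : χ u + 1 = d
        · have := hlev' u hu v hv huv hu2 hv1
          omega
        · have hm := hmemT u hu h1 hu2
          exact h2 ⟨hm, by rwa [show lev u = L by omega]⟩
      rwa [hInv_after v y hv1 hv3 ⟨L, hL, by omega⟩]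
    · have hg := (hInv_before u x h1 h2 h3).1 hI
      rcases hρ_small u hu h1 h2 x with h | ⟨hs, ho, -⟩
      · refine hgood ?_
        rwa [shiftReset_of_lt h]
      · exfalso
        have huv' : u = v := by
          by_contra hne
          have := hs_pos u hu v hv hne
          omega
        have := hlev' u hu v hv huv ho hv1
        rw [huv'] at this
        omega
  refine ⟨ρ, Inv, hlt, hentry, hnot_junk, heven, hnot_junk_reset, hpreserve, ?_⟩
  intro u x hu hH hstep
  by_cases hinf : ∀ N, ∃ n ≥ N, χ (u n) = d
  · have hcardle : ∀ n, (junkSet d (s + 1) (x (n + 1))).card ≤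
        ((junkSet d (s + 1) (x n)).erase (ρ (u n) (x n))).card := fun n =>
      card_junkSet_le (hlt _ (hu n) _) (hcol _ (hu _)) (hstep n)
    obtain ⟨M, hM1, hM⟩ := exists_eventually_const_of_antitone (N := 1)
      (f := fun n => (junkSet d (s + 1) (x n)).card)
      (fun n _ => (hcardle n).trans (Finset.card_le_card (Finset.erase_subset _ _)))
    have hclean : ∀ n ≥ M, χ (u n) = d → ¬ ∃ k, k < s + 1 ∧ Junk d (x n k) := by
      intro n hn hd' hj
      have h1 := hρ_top_junk (u n) (x n) hd' hj
      have h2 := Finset.card_erase_lt_of_mem (mem_junkSet.2 h1)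
      have h3 := hcardle n
      have h4 := hM n hn
      have h5 := hM (n + 1) (by omega)
      omega
    obtain ⟨m, hm, hmd⟩ := hinf M
    have hI : Inv (u m) (x m) := by
      rw [hInv_top _ _ hmd]
      refine ⟨fun hj => hclean m hm hmd ⟨s, by omega, hj⟩, fun k hk => ?_⟩
      obtain ⟨p, rfl⟩ : ∃ p, m = p + 1 := ⟨m - 1, by omega⟩
      rw [hstep p k hk, hmd]
      exact le_max_left _ _
    have hI' : ∀ n ≥ m, Inv (u n) (x n) := by
      intro n hn
      induction n, hn using Nat.le_induction with
      | base => exact hI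
      | succ n hn ih => exact hpreserve _ (hu n) _ (hu _) (hH n) _ _ ih (hstep n)
    refine ⟨s, by omega, fun N => ?_, m, fun n hn => ⟨?_, heven _ (hu n) _ (hI' n hn)⟩⟩
    · obtain ⟨n, hn, hnd⟩ := hinf (max N M)
      exact ⟨n, (le_max_left _ _).trans hn,
        hρ_top _ _ hnd (hclean n ((le_max_right _ _).trans hn) hnd)⟩
    · have := hlt _ (hu n) (x n); omega
  · push Not at hinf
    obtain ⟨N, hN⟩ := hinf
    obtain ⟨M, hMN, hM⟩ := exists_eventually_const_of_antitone (N := N) (f := fun n => lev (u n))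
      (fun n hn => hlev _ (hu n) _ (hu _) (hH n) (hN n hn) (hN _ (by omega)))
    have hmT : ∀ n ≥ M, u n ∈ T (lev (u M)) := by
      intro n hn
      have h1 := hM n hn
      have h2 := hM (n + 1) (by omega)
      rw [← h1]
      refine hmemT _ (hu n) (hN n (by omega)) fun ho => ?_
      have := hlev' _ (hu n) _ (hu _) (hH n) ho (hN _ (by omega))
      omega
    have hρn : ∀ n ≥ M, ρ (u n) (x n) = ρ' (lev (u M)) (u n) (x n) := by
      intro n hn
      have := hM n hn
      rw [← this]
      exact hρ_low _ _ (by rw [this]; exact hmT n hn)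
    have hstep' : ∀ n, RegStep (s + 1) (ρ' (lev (u M)) (u (M + n)) (x (M + n)))
        (χ (u (M + n + 1))) (x (M + n)) (x (M + n + 1)) := fun n => by
      rw [← hρn _ (by omega)]; exact hstep (M + n)
    have hfin : ∃ j < s + 1, (∀ N, ∃ n ≥ N, ρ' (lev (u M)) (u (M + n)) (x (M + n)) = j) ∧
        ∃ N, ∀ n ≥ N, ρ' (lev (u M)) (u (M + n)) (x (M + n)) ≤ j ∧
          (ρ' (lev (u M)) (u (M + n)) (x (M + n)) = j → x (M + n) j % 2 = 0) := by
      by_cases hl : Large (lev (u M))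
      · exact (hbig _ hl).win (fun n => u (M + n)) (fun n => x (M + n))
          (fun n => hmT _ (by omega)) (fun n => hH (M + n)) hstep'
      · obtain ⟨j, hj, h⟩ := (hsmall _ hl).win (fun n => u (M + n)) (fun n => x (M + n))
          (fun n => hmT _ (by omega)) (fun n => hH (M + n))
          (fun n k hk => hstep' n k (by omega))
        exact ⟨j, by omega, h⟩
    obtain ⟨j, hj, h1, N', h2⟩ := hfin
    refine ⟨j, hj, fun K => ?_, M + N', fun n hn => ?_⟩
    · obtain ⟨n, hn, hnj⟩ := h1 K
      exact ⟨M + n, by omega, by rw [hρn _ (by omega)]; exact hnj⟩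
    · have := h2 (n - M) (by omega)
      rw [show M + (n - M) = n by omega] at this
      rwa [hρn n (by omega)]

theorem exists_defensiveOn
    (hcyc : ∀ o, χ o % 2 = 1 →
      ¬ TransGen (fun a b => H a b ∧ χ a ≤ χ o ∧ χ b ≤ χ o) o o)
    (e : ℕ) : ∀ (r : ℕ) (S : Finset V), S.card < 2 ^ r → (∀ u ∈ S, χ u ≤ 2 * e) →
      ∃ ρ Inv, DefensiveOn H χ S (2 * e) r ρ Inv := by
  classical
  induction e with
  | zero =>
    intro r S hcard hcol
    rcases r with - | s
    · obtain rfl : S = ∅ := Finset.card_eq_zero.1 (by simpa using hcard)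
      exact ⟨_, _, defensiveOn_empty _ _ _ _⟩
    refine exists_defensiveOn_of_layers (by omega) hcard hcol (fun _ => 0)
      (fun _ _ _ _ _ _ _ => le_rfl) (fun _ _ _ _ _ h => by omega) (fun _ => ∅)
      (fun l u => ⟨fun h => by simp at h, fun h => by omega⟩)
      (fun l r _ => ⟨_, _, defensiveOn_empty _ _ _ _⟩)
  | succ e ih =>
    intro r S hcard hcol
    rcases r with - | s
    · obtain rfl : S = ∅ := Finset.card_eq_zero.1 (by simpa using hcard)
      exact ⟨_, _, defensiveOn_empty _ _ _ _⟩
    let R : V → V → Prop := fun a b => H a b ∧ (a ∈ S ∧ χ a ≠ 2 * (e + 1)) ∧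
      (b ∈ S ∧ χ b ≠ 2 * (e + 1))
    let O : V → Finset V := fun u =>
      S.filter fun o => χ o + 1 = 2 * (e + 1) ∧ ReflTransGen R u o
    have hO : ∀ u v, R u v → O v ⊆ O u := by
      intro u v huv o ho
      simp only [O, Finset.mem_filter] at ho ⊢
      exact ⟨ho.1, ho.2.1, ho.2.2.head huv⟩
    refine exists_defensiveOn_of_layers (by omega) hcard hcol (fun u => (O u).card) ?_ ?_
      (fun l => S.filter fun u => χ u + 2 ≤ 2 * (e + 1) ∧ (O u).card = l)
      (fun l u => by simp) ?_
    · intro u hu v hv huv h1 h2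
      exact Finset.card_le_card (hO u v ⟨huv, ⟨hu, h1⟩, hv, h2⟩)
    · intro u hu v hv huv h1 h2
      have hR : R u v := ⟨huv, ⟨hu, by omega⟩, hv, h2⟩
      refine Finset.card_lt_card ((Finset.ssubset_iff_of_subset (hO u v hR)).2 ⟨u, ?_, ?_⟩)
      · simp only [O, Finset.mem_filter]
        exact ⟨hu, h1, ReflTransGen.refl⟩
      · simp only [O, Finset.mem_filter]
        rintro ⟨-, -, hvu⟩
        refine hcyc u (by omega) (TransGen.mono ?_ _ _ (TransGen.head' hR hvu))
        rintro a b ⟨hab, ⟨ha, ha'⟩, hb, hb'⟩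
        have := hcol a ha
        have := hcol b hb
        exact ⟨hab, by omega, by omega⟩
    · intro l r' hr'
      refine ih r' _ hr' fun u hu => ?_
      have := (Finset.mem_filter.1 hu).2.1
      omega

end ResetStrategies

section Determinacy

variable {V : Type}

/-- The moves inside `W` in which the owner of `P` plays according to `σ`. -/
def StratMove (E : V → V → Prop) (P W : Set V) (σ : V → V) (a b : V) : Prop :=
  a ∈ W ∧ b ∈ W ∧ E a b ∧ (a ∈ P → b = σ a)

/-- In the game restricted to `S`, the owner of `P` can stay inside `W` by playing `σ`, and no
cycle of the resulting graph has a maximal color of parity different from `par`. -/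
structure WinCert (E : V → V → Prop) (χ : V → ℕ) (S P : Set V) (par : ℕ) (W : Set V)
    (σ : V → V) : Prop where
  sub : W ⊆ S
  own : ∀ u ∈ W, u ∈ P → E u (σ u) ∧ σ u ∈ W
  opp : ∀ u ∈ W, u ∉ P → ∀ w ∈ S, E u w → w ∈ W
  acyc : ∀ o, χ o % 2 ≠ par →
    ¬ TransGen (fun a b => StratMove E P W σ a b ∧ χ a ≤ χ o ∧ χ b ≤ χ o) o o

variable {E : V → V → Prop} {χ : V → ℕ} {S P : Set V} {par : ℕ}

/-- A path that ends outside of a set closed under steps avoids that set. -/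
lemma transGen_restrict_of_closed {R : V → V → Prop} {Q : V → Prop}
    (hQ : ∀ a b, R a b → Q a → Q b) {a o : V} (h : TransGen R a o) (ho : ¬ Q o) :
    TransGen (fun a b => R a b ∧ ¬ Q a ∧ ¬ Q b) a o ∧ ¬ Q a := by
  induction h using TransGen.head_induction_on with
  | single h =>
    have := fun hq => ho (hQ _ _ h hq)
    exact ⟨TransGen.single ⟨h, this, ho⟩, this⟩
  | head h _ ih =>
    have := fun hq => ih.2 (hQ _ _ h hq)
    exact ⟨TransGen.head ⟨h, this, ih.2⟩ ih.1, this⟩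

lemma transGen_mem_of_closed {R : V → V → Prop} {Q : V → Prop}
    (hQ : ∀ a b, R a b → Q a → Q b) {a o : V} (h : TransGen R a o) (ha : Q a) :
    TransGen (fun a b => R a b ∧ Q a ∧ Q b) a o := by
  suffices TransGen (fun a b => R a b ∧ Q a ∧ Q b) a o ∧ Q o from this.1
  induction h with
  | single h => exact ⟨TransGen.single ⟨h, ha, hQ _ _ h ha⟩, hQ _ _ h ha⟩
  | tail _ h ih => exact ⟨ih.1.tail ⟨h, ih.2, hQ _ _ h ih.2⟩, hQ _ _ h ih.2⟩

open Classical in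
/-- Extension of a winning certificate by vertices from which one either reaches the old region
or follows a strategy without bad cycles. -/
lemma WinCert.extend {W : Set V} {σ : V → V} (h : WinCert E χ S P par W σ) {Y : Set V}
    (τ : V → V) (hY : Y ⊆ S)
    (hown : ∀ u ∈ Y, u ∉ W → u ∈ P → E u (τ u) ∧ τ u ∈ W ∪ Y)
    (hopp : ∀ u ∈ Y, u ∉ W → u ∉ P → ∀ w ∈ S, E u w → w ∈ W ∪ Y)
    (hacyc : ∀ o, χ o % 2 ≠ par →
      ¬ TransGen (fun a b => StratMove E P (Y \ W) τ a b ∧ χ a ≤ χ o ∧ χ b ≤ χ o) o o) :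
    WinCert E χ S P par (W ∪ Y) (fun u => if u ∈ W then σ u else τ u) := by
  refine ⟨Set.union_subset h.sub hY, ?_, ?_, ?_⟩
  · intro u hu hP
    by_cases hW : u ∈ W
    · simp only [if_pos hW]
      exact ⟨(h.own u hW hP).1, Or.inl (h.own u hW hP).2⟩
    · simp only [if_neg hW]
      exact hown u (hu.resolve_left hW) hW hP
  · intro u hu hP w hw huw
    by_cases hW : u ∈ W
    · exact Or.inl (h.opp u hW hP w hw huw)
    · exact hopp u (hu.resolve_left hW) hW hP w hw huw
  · intro o ho hc
    have hclosed : ∀ a b, (StratMove E P (W ∪ Y) (fun u => if u ∈ W then σ u else τ u) a b ∧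
        χ a ≤ χ o ∧ χ b ≤ χ o) → a ∈ W → b ∈ W := by
      rintro a b ⟨⟨-, hb, hab, hσ⟩, -⟩ ha
      by_cases hP : a ∈ P
      · rw [hσ hP]
        simp only [if_pos ha]
        exact (h.own a ha hP).2
      · exact h.opp a ha hP b (hb.elim (fun h' => h.sub h') fun h' => hY h') hab
    by_cases hoW : o ∈ W
    · refine h.acyc o ho (TransGen.mono ?_ _ _ (transGen_mem_of_closed hclosed hc hoW))
      rintro a b ⟨⟨⟨-, -, hab, hσ⟩, hcol⟩, ha, hb⟩
      exact ⟨⟨ha, hb, hab, fun hP => by simpa [ha] using hσ hP⟩, hcol⟩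
    · refine hacyc o ho (TransGen.mono ?_ _ _ (transGen_restrict_of_closed hclosed hc hoW).1)
      rintro a b ⟨⟨⟨ha', hb', hab, hσ⟩, hcol⟩, ha, hb⟩
      exact ⟨⟨⟨ha'.resolve_left ha, ha⟩, ⟨hb'.resolve_left hb, hb⟩, hab,
        fun hP => by simpa [ha] using hσ hP⟩, hcol⟩

lemma winCert_empty (E : V → V → Prop) (χ : V → ℕ) (S P : Set V) (par : ℕ) :
    WinCert E χ S P par ∅ id where
  sub := Set.empty_subset _
  own := by simp
  opp := by simp
  acyc := by
    intro o _ h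
    obtain ⟨b, hb, -⟩ := TransGen.head'_iff.1 h
    exact hb.1.1

lemma exists_greatest_winCert [Finite V] (E : V → V → Prop) (χ : V → ℕ) (S P : Set V) (par : ℕ) :
    ∃ W σ, WinCert E χ S P par W σ ∧ ∀ W' σ', WinCert E χ S P par W' σ' → W' ⊆ W := by
  obtain ⟨W, ⟨σ, hσ⟩, hmax⟩ := (Set.toFinite {W | ∃ σ, WinCert E χ S P par W σ}).exists_maximal
    ⟨∅, id, winCert_empty ..⟩
  refine ⟨W, σ, hσ, fun W' σ' h' => ?_⟩
  have := hσ.extend σ' h'.sub (fun u hu _ hP => ⟨(h'.own u hu hP).1, Or.inr (h'.own u hu hP).2⟩)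
    (fun u hu _ hP w hw huw => Or.inr (h'.opp u hu hP w hw huw)) (fun o ho hc => by
      refine h'.acyc o ho (TransGen.mono ?_ _ _ hc)
      rintro a b ⟨⟨ha, hb, hab⟩, hcol⟩
      exact ⟨⟨ha.1, hb.1, hab⟩, hcol⟩)
  exact Set.subset_union_right.trans (hmax ⟨_, this⟩ Set.subset_union_left)

/-- The greatest winning region is closed under forced moves. -/
lemma mem_of_forced {W : Set V} {σ : V → V} (h : WinCert E χ S P par W σ)
    (hmax : ∀ W' σ', WinCert E χ S P par W' σ' → W' ⊆ W) {u : V} (hu : u ∈ S)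
    (hf : (u ∈ P ∧ ∃ w ∈ W, E u w) ∨ (u ∉ P ∧ ∀ w ∈ S, E u w → w ∈ W)) : u ∈ W := by
  by_contra hW
  obtain ⟨τ, hτ⟩ : ∃ τ : V → V, u ∈ P → E u (τ u) ∧ τ u ∈ W := by
    rcases hf with ⟨_, w, hw, huw⟩ | ⟨hP, -⟩
    · exact ⟨fun _ => w, fun _ => ⟨huw, hw⟩⟩
    · exact ⟨id, fun h => absurd h hP⟩
  refine hW (hmax _ _ (h.extend (Y := {u}) τ (by simpa using hu) ?_ ?_ ?_) (Or.inr rfl))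
  · rintro _ rfl _ hP
    exact ⟨(hτ hP).1, Or.inl (hτ hP).2⟩
  · rintro _ rfl _ hP w hw huw
    exact Or.inl ((hf.resolve_left fun h => hP h.1).2 w hw huw)
  · intro o _ hc
    obtain ⟨b, ⟨⟨ho, hb, hob, hσ⟩, -⟩, -⟩ := TransGen.head'_iff.1 hc
    obtain ⟨rfl, -⟩ := ho
    obtain ⟨rfl, -⟩ := hb
    by_cases hP : b ∈ P
    · exact hW (by rw [hσ hP]; exact (hτ hP).2)
    · exact hW ((hf.resolve_left fun h => hP h.1).2 b hu hob)

/-- The stages of the attractor of `D` inside `U` for the owner of `P`. -/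
def attrStage (E : V → V → Prop) (P U D : Set V) : ℕ → Set V
  | 0 => D
  | n + 1 => attrStage E P U D n ∪ {u | u ∈ U ∧
      ((u ∈ P ∧ ∃ w ∈ attrStage E P U D n, E u w) ∨
        (u ∉ P ∧ ∀ w ∈ U, E u w → w ∈ attrStage E P U D n))}

/-- Existence of attractors, with a rank decreasing along attracting moves. -/
lemma exists_attractor [Finite V] (E : V → V → Prop) (P U D : Set V) (hD : D ⊆ U) :
    ∃ (A : Set V) (rk : V → ℕ), D ⊆ A ∧ A ⊆ U ∧
      (∀ u ∈ U, u ∉ A → (u ∈ P → ∀ w ∈ A, ¬ E u w) ∧ (u ∉ P → ∃ w ∈ U, E u w ∧ w ∉ A)) ∧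
      ∀ u ∈ A, u ∉ D → (u ∈ P → ∃ w ∈ A, E u w ∧ rk w < rk u) ∧
        (u ∉ P → ∀ w ∈ U, E u w → w ∈ A ∧ rk w < rk u) := by
  classical
  set F := attrStage E P U D with hF
  have hmono : Monotone F := monotone_nat_of_le_succ fun n => Set.subset_union_left
  let A : Set V := {u | ∃ n, u ∈ F n}
  let rk : V → ℕ := fun u => if h : ∃ n, u ∈ F n then Nat.find h else 0
  have hrk : ∀ u n, u ∈ F n → rk u ≤ n := by
    intro u n hu
    have h : ∃ n, u ∈ F n := ⟨n, hu⟩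
    simp only [rk, dif_pos h]
    exact Nat.find_min' h hu
  have hsub : ∀ n, F n ⊆ U := by
    intro n
    induction n with
    | zero => exact hD
    | succ n ih => exact Set.union_subset ih fun u hu => hu.1
  refine ⟨A, rk, fun u hu => ⟨0, hu⟩, fun u ⟨n, hn⟩ => hsub n hn, ?_, ?_⟩
  · intro u hu hA
    refine ⟨fun hP w ⟨n, hn⟩ huw => hA ⟨n + 1, Or.inr ⟨hu, Or.inl ⟨hP, w, hn, huw⟩⟩⟩, ?_⟩
    intro hP
    by_contra! hno
    choose! g hg using hno
    obtain ⟨N, hN⟩ := (Set.finite_range g).bddAbove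
    exact hA ⟨N + 1, Or.inr ⟨hu, Or.inr ⟨hP, fun w hw huw =>
      hmono (hN ⟨w, rfl⟩) (hg w hw huw)⟩⟩⟩
  · intro u hu hD'
    obtain ⟨n, hn, hmem⟩ : ∃ n, rk u = n + 1 ∧ u ∈ F (n + 1) ∧ u ∉ F n := by
      have hk : rk u = Nat.find hu := by simp only [rk, dif_pos (show ∃ n, u ∈ F n from hu)]
      have hspec := Nat.find_spec hu
      obtain ⟨n, hn⟩ : ∃ n, Nat.find hu = n + 1 := by
        refine Nat.exists_eq_succ_of_ne_zero fun h0 => hD' ?_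
        rw [h0] at hspec
        exact hspec
      rw [hn] at hspec
      exact ⟨n, hk.trans hn, hspec, Nat.find_min hu (by omega)⟩
    have hf := (hmem.1.resolve_left hmem.2).2
    rcases hf with ⟨hP, w, hw, huw⟩ | ⟨hP, hall⟩
    · refine ⟨fun _ => ⟨w, ⟨n, hw⟩, huw, ?_⟩, fun h => absurd hP h⟩
      have := hrk w n hw
      omega
    · refine ⟨fun h => absurd h hP, fun _ w hw huw => ⟨⟨n, hall w hw huw⟩, ?_⟩⟩
      have := hrk w n (hall w hw huw)
      omega

/-- If the undecided part `U` of the game is nonempty, it cannot have a maximal color of parity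
`par`. -/
lemma false_of_undecided [Finite V] {par' : ℕ}
    (ih : ∀ S' ⊂ S, ∀ v ∈ S', (∃ W σ, WinCert E χ S' P par W σ ∧ v ∈ W) ∨
      ∃ W σ, WinCert E χ S' Pᶜ par' W σ ∧ v ∈ W)
    {W W' : Set V} {σ σ' : V → V} (h : WinCert E χ S P par W σ)
    (hmax : ∀ W₁ σ₁, WinCert E χ S P par W₁ σ₁ → W₁ ⊆ W)
    (h' : WinCert E χ S Pᶜ par' W' σ')
    (hmax' : ∀ W₁ σ₁, WinCert E χ S Pᶜ par' W₁ σ₁ → W₁ ⊆ W')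
    {t : V} (ht : t ∈ S \ (W ∪ W')) (htmax : ∀ u ∈ S \ (W ∪ W'), χ u ≤ χ t)
    (hpar : χ t % 2 = par) : False := by
  classical
  set U := S \ (W ∪ W') with hU
  have hUS : U ⊆ S := Set.sdiff_subset
  have hcases : ∀ w ∈ S, w ∈ W ∨ w ∈ W' ∨ w ∈ U := by
    intro w hw
    by_cases h1 : w ∈ W
    · exact Or.inl h1
    by_cases h2 : w ∈ W'
    · exact Or.inr (Or.inl h2)
    · exact Or.inr (Or.inr ⟨hw, fun h => h.elim h1 h2⟩)
  have hUW : ∀ u ∈ U, u ∉ W := fun u hu hw => hu.2 (Or.inl hw)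
  have hUW' : ∀ u ∈ U, u ∉ W' := fun u hu hw => hu.2 (Or.inr hw)
  have hnoW : ∀ u ∈ U, u ∈ P → ∀ w ∈ W, ¬ E u w := fun u hu hP w hw huw =>
    hUW u hu (mem_of_forced h hmax (hUS hu) (Or.inl ⟨hP, w, hw, huw⟩))
  have hnoW' : ∀ u ∈ U, u ∉ P → ∀ w ∈ W', ¬ E u w := fun u hu hP w hw huw =>
    hUW' u hu (mem_of_forced h' hmax' (hUS hu) (Or.inl ⟨hP, w, hw, huw⟩))
  have hsucc : ∀ u ∈ U, u ∈ P → ∃ w ∈ U, E u w := by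
    intro u hu hP
    by_contra! hno
    refine hUW' u hu (mem_of_forced h' hmax' (hUS hu) (Or.inr ⟨fun hn => hn hP, ?_⟩))
    intro w hw huw
    rcases hcases w hw with h1 | h1 | h1
    · exact absurd huw (hnoW u hu hP w h1)
    · exact h1
    · exact absurd huw (hno w h1)
  obtain ⟨A, rk, hDA, hAU, hout, hin⟩ :=
    exists_attractor E P U {u | u ∈ U ∧ χ u = χ t} fun u hu => hu.1
  have htA : t ∈ A := hDA ⟨ht, rfl⟩
  have hss : U \ A ⊂ S :=
    ⟨Set.sdiff_subset.trans hUS, fun hc => (hc (hUS ht)).2 htA⟩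
  obtain ⟨X, τ, hX, hXmax⟩ := exists_greatest_winCert E χ (U \ A) P par
  have hXall : ∀ u ∈ U, u ∉ A → u ∈ X := by
    intro u hu hA
    rcases ih _ hss u ⟨hu, hA⟩ with ⟨Y, τ', hY, huY⟩ | ⟨Y, τ', hY, huY⟩
    · exact hXmax _ _ hY huY
    refine absurd (hmax' _ _ (h'.extend τ' (hY.sub.trans hss.1) ?_ ?_ ?_) (Or.inr huY))
      (hUW' u hu)
    · exact fun u hu _ hP => ⟨(hY.own u hu hP).1, Or.inr (hY.own u hu hP).2⟩
    · intro u hu _ hP w hw huw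
      have huU := hY.sub hu
      rcases hcases w hw with h1 | h1 | h1
      · exact absurd huw (hnoW u huU.1 (not_not.1 hP) w h1)
      · exact Or.inl h1
      · exact Or.inr (hY.opp u hu hP w
          ⟨h1, fun hwA => (hout u huU.1 huU.2).1 (not_not.1 hP) w hwA huw⟩ huw)
    · intro o ho hc
      refine hY.acyc o ho (TransGen.mono ?_ _ _ hc)
      rintro a b ⟨⟨ha, hb, hab⟩, hcol⟩
      exact ⟨⟨ha.1, hb.1, hab⟩, hcol⟩
  have hchoice : ∀ u, ∃ w, (u ∈ U → u ∈ P → w ∈ U ∧ E u w) ∧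
      (u ∈ A → u ∈ P → χ u ≠ χ t → w ∈ A ∧ rk w < rk u) ∧
      (u ∈ U → u ∈ P → u ∉ A → w = τ u) := by
    intro u
    by_cases hu : u ∈ U ∧ u ∈ P
    swap
    · exact ⟨u, fun h1 h2 => absurd ⟨h1, h2⟩ hu, fun h1 h2 => absurd ⟨hAU h1, h2⟩ hu,
        fun h1 h2 => absurd ⟨h1, h2⟩ hu⟩
    by_cases hA : u ∈ A
    · by_cases hd : χ u = χ t
      · obtain ⟨w, hw, huw⟩ := hsucc u hu.1 hu.2
        exact ⟨w, fun _ _ => ⟨hw, huw⟩, fun _ _ h => absurd hd h, fun _ _ h => absurd hA h⟩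
      · obtain ⟨w, hw, huw, hlt⟩ := (hin u hA fun h => hd h.2).1 hu.2
        exact ⟨w, fun _ _ => ⟨hAU hw, huw⟩, fun _ _ _ => ⟨hw, hlt⟩, fun _ _ h => absurd hA h⟩
    · have := hX.own u (hXall u hu.1 hA) hu.2
      exact ⟨τ u, fun _ _ => ⟨(hX.sub this.2).1, this.1⟩, fun h => absurd h hA,
        fun _ _ _ => rfl⟩
  choose θ hθ using hchoice
  refine hUW t ht (hmax _ _ (h.extend θ hUS ?_ ?_ ?_) (Or.inr ht))
  · exact fun u hu _ hP => ⟨((hθ u).1 hu hP).2, Or.inr ((hθ u).1 hu hP).1⟩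
  · intro u hu _ hP w hw huw
    rcases hcases w hw with h1 | h1 | h1
    · exact Or.inl h1
    · exact absurd huw (hnoW' u hu hP w h1)
    · exact Or.inr h1
  · intro o ho hc
    have hmove : ∀ a b, (StratMove E P (U \ W) θ a b ∧ χ a ≤ χ o ∧ χ b ≤ χ o) → a ∈ A →
        b ∈ A ∧ rk b < rk a := by
      rintro a b ⟨⟨ha, hb, hab, hσ⟩, hao, hbo⟩ haA
      have hne : χ a ≠ χ t := by
        intro hat
        obtain ⟨c, -, hc'⟩ := TransGen.tail'_iff.1 hc
        have := htmax o hc'.1.2.1.1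
        exact ho (by rw [show χ o = χ t by omega]; exact hpar)
      by_cases hP : a ∈ P
      · rw [hσ hP]; exact (hθ a).2.1 haA hP hne
      · exact (hin a haA fun h => hne h.2).2 hP b hb.1 hab
    by_cases hoA : o ∈ A
    · have hdec := transGen_mem_of_closed (fun a b hab ha => (hmove a b hab ha).1) hc hoA
      have : TransGen (fun m n : ℕ => n < m) (rk o) (rk o) :=
        TransGen.lift rk (fun a b hab => (hmove a b hab.1 hab.2.1).2) _ _ hdec
      have hlt : ∀ m n : ℕ, TransGen (fun m n : ℕ => n < m) m n → n < m := by
        intro m n hmn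
        induction hmn with
        | single h => exact h
        | tail _ h ih => omega
      exact lt_irrefl _ (hlt _ _ this)
    · have hres := (transGen_restrict_of_closed
        (fun a b hab ha => (hmove a b hab ha).1) hc hoA).1
      refine hX.acyc o ho (TransGen.mono ?_ _ _ hres)
      rintro a b ⟨⟨⟨ha, hb, hab, hσ⟩, hcol⟩, haA, hbA⟩
      exact ⟨⟨hXall a ha.1 haA, hXall b hb.1 hbA, hab, fun hP =>
        (hσ hP).trans ((hθ a).2.2 ha.1 hP haA)⟩, hcol⟩

/-- Positional determinacy of finite parity games. -/
theorem exists_winCert [Finite V] (E : V → V → Prop) (χ : V → ℕ) (P S : Set V) :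
    ∀ v ∈ S, (∃ W σ, WinCert E χ S P 0 W σ ∧ v ∈ W) ∨
      ∃ W σ, WinCert E χ S Pᶜ 1 W σ ∧ v ∈ W := by
  induction S using WellFoundedLT.induction with
  | ind S ih =>
    intro v hv
    obtain ⟨W, σ, h, hmax⟩ := exists_greatest_winCert E χ S P 0
    obtain ⟨W', σ', h', hmax'⟩ := exists_greatest_winCert E χ S Pᶜ 1
    by_contra! hno
    have hvU : v ∈ S \ (W ∪ W') := ⟨hv, fun hW =>
      hW.elim (fun hw => hno.1 _ _ h hw) fun hw => hno.2 _ _ h' hw⟩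
    obtain ⟨t, ht, htmax⟩ := (Set.toFinite (S \ (W ∪ W'))).exists_maximalFor χ _ ⟨v, hvU⟩
    have htmax' : ∀ u ∈ S \ (W ∪ W'), χ u ≤ χ t := fun u hu =>
      (le_total (χ u) (χ t)).elim id fun hle => htmax hu hle
    rcases Nat.mod_two_eq_zero_or_one (χ t) with hpar | hpar
    · exact false_of_undecided (fun S' hS' => ih S' hS') h hmax h' hmax' ht htmax' hpar
    · rw [Set.union_comm] at ht htmax'
      rw [← compl_compl P] at h hmax
      refine false_of_undecided (fun S' hS' u hu => ?_) h' hmax' h hmax ht htmax' hpar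
      rw [compl_compl]
      exact (ih S' hS' u hu).symm

end Determinacy

section Plays

lemma exists_limsup_of_bounded {f : ℕ → ℕ} {B : ℕ} (hB : ∀ n, f n ≤ B) :
    ∃ c, (∀ N, ∃ n ≥ N, f n = c) ∧ ∃ N, ∀ n ≥ N, f n ≤ c := by
  classical
  have hex : ∃ c, ∃ N, ∀ n ≥ N, f n ≤ c := ⟨B, 0, fun n _ => hB n⟩
  obtain ⟨M, hM⟩ := Nat.find_spec hex
  refine ⟨Nat.find hex, fun N => ?_, M, hM⟩
  by_contra! hne
  have hlt : ∀ n ≥ max M N, f n < Nat.find hex := fun n hn =>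
    lt_of_le_of_ne (hM n (le_of_max_le_left hn)) (hne n (le_of_max_le_right hn))
  have hpos := hlt _ le_rfl
  refine Nat.find_min hex (m := Nat.find hex - 1) (by omega) ⟨max M N, fun n hn => ?_⟩
  have := hlt n hn
  omega

/-- In a graph with bounded colors the two players cannot both win from the same vertex. -/
lemma not_winsAt_both {X : Type} {E : X → X → Prop} {χ : X → ℕ} {Vi Vj : Set X}
    (hcov : ∀ u, u ∈ Vi ∨ u ∈ Vj) (hdisj : ∀ u, u ∈ Vi → u ∉ Vj) {B : ℕ}
    (hB : ∀ a b, E a b → χ b ≤ B) {v : X}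
    (h₁ : WinsAt E Vi (ParityWinSet E χ Vj 0 ∪ ParityWinSet E χ Vi 1) (ParityWinSet E χ Vj 0) v)
    (h₂ : WinsAt E Vj (ParityWinSet E χ Vj 0 ∪ ParityWinSet E χ Vi 1) (ParityWinSet E χ Vi 1) v) :
    False := by
  classical
  obtain ⟨s, hs, hvs⟩ := h₁
  obtain ⟨t, ht, hvt⟩ := h₂
  have hnext : ∀ u, ∃ o : Option X, (∀ w, o = some w → E u w) ∧ (o = none → ∀ w, ¬ E u w) ∧
      (∀ w, s.σ u = some w → o = some w) ∧ (∀ w, t.σ u = some w → o = some w) := by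
    intro u
    rcases hsu : s.σ u with - | w
    · rcases htu : t.σ u with - | w
      · by_cases h : ∃ w, E u w
        · obtain ⟨w, hw⟩ := h
          exact ⟨some w, by simpa using hw, by simp, by simp, by simp⟩
        · exact ⟨none, by simp, by simpa using h, by simp, by simp⟩
      · have := (t.dom _ _ htu).2.2.1
        exact ⟨some w, by simpa using this, by simp, by simp, by simp⟩
    · have := s.dom _ _ hsu
      refine ⟨some w, by simpa using this.2.2.1, by simp, by simp, fun w' hw' => ?_⟩
      exact absurd (t.dom _ _ hw').2.1 (hdisj u this.2.1)
  choose next hE hsink hns hnt using hnext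
  let f : ℕ → Option X := fun n => Nat.rec (some v) (fun _ o => o.bind next) n
  have hf : ∀ n, f (n + 1) = (f n).bind next := fun n => rfl
  let α : Play X E :=
    { f := f
      first := rfl
      closed := fun k hk => by rw [hf, hk]; rfl
      step := fun k u w hu hw => by
        rw [hf, hu] at hw
        exact hE u w hw }
  have hclosed : ∀ k m, k ≤ m → f k = none → f m = none := by
    intro k m hkm hk
    induction m, hkm using Nat.le_induction with
    | base => exact hk
    | succ m _ ih => exact α.closed m ih
  have hfin_of : ∀ k, f k = none →
      ∃ n u, f n = some u ∧ f (n + 1) = none ∧ ∀ w, ¬ E u w := by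
    intro k hk
    induction k with
    | zero => exact absurd hk (by simp [f])
    | succ k ih =>
      rcases hu : f k with - | u
      · exact ih hu
      · refine ⟨k, u, hu, hk, hsink u ?_⟩
        rw [hf, hu] at hk
        exact hk
  have hmax : α.IsMax := by
    rcases Classical.em (∀ k, f k ≠ none) with hinf | hinf
    · exact Or.inl hinf
    · obtain ⟨k, hk⟩ := not_forall_not.1 hinf
      exact Or.inr (hfin_of k hk)
  have hC : α ∈ ParityWinSet E χ Vj 0 ∪ ParityWinSet E χ Vi 1 := by
    rcases Classical.em (∀ k, f k ≠ none) with hinf | hinf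
    · have hp : ∀ k, ∃ u, f k = some u := fun k => Option.ne_none_iff_exists'.1 (hinf k)
      choose p hp using hp
      have hstep : ∀ k, E (p k) (p (k + 1)) := fun k => α.step k _ _ (hp k) (hp (k + 1))
      obtain ⟨c, hc, N, hN⟩ := exists_limsup_of_bounded (f := fun k => χ (p (k + 1)))
        fun k => hB _ _ (hstep k)
      have hocc : InfOcc χ α c := by
        intro M
        obtain ⟨n, hn, hnc⟩ := hc M
        exact ⟨n + 1, by omega, p (n + 1), hp (n + 1), hnc⟩
      have hle : ∀ c', InfOcc χ α c' → c' ≤ c := by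
        intro c' hc'
        obtain ⟨k, hk, u, hu, rfl⟩ := hc' (N + 1)
        obtain ⟨n, rfl⟩ : ∃ n, k = n + 1 := ⟨k - 1, by omega⟩
        have : p (n + 1) = u := Option.some_injective _ ((hp _).symm.trans hu)
        rw [← this]
        exact hN n (by omega)
      rcases Nat.mod_two_eq_zero_or_one c with h0 | h1
      · exact Or.inl ⟨hmax, Or.inr ⟨hinf, c, hocc, h0, hle⟩⟩
      · exact Or.inr ⟨hmax, Or.inr ⟨hinf, c, hocc, h1, hle⟩⟩
    · obtain ⟨k, hk⟩ := not_forall_not.1 hinf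
      obtain ⟨n, u, hu, hn, -⟩ := hfin_of k hk
      rcases hcov u with h | h
      · exact Or.inr ⟨hmax, Or.inl ⟨n, u, hu, hn, h⟩⟩
      · exact Or.inl ⟨hmax, Or.inl ⟨n, u, hu, hn, h⟩⟩
  have hfs : α.Follows s := by
    intro k u w hu hw _
    change f (k + 1) = some w
    rw [hf, show f k = some u from hu]
    exact hns u w hw
  have hft : α.Follows t := by
    intro k u w hu hw _
    change f (k + 1) = some w
    rw [hf, show f k = some u from hu]
    exact hnt u w hw
  obtain ⟨-, hw₁⟩ := hs α hC ⟨v, rfl, hvs⟩ hfs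
  obtain ⟨-, hw₂⟩ := ht α hC ⟨v, rfl, hvt⟩ hft
  rcases hw₁ with ⟨n, u, hu, hn, hu'⟩ | ⟨hinf, c, hc, hc0, hcm⟩ <;>
    rcases hw₂ with ⟨m, w, hw, hm, hw'⟩ | ⟨hinf', c', hc', hc1, hcm'⟩
  · have hnm : n = m := by
      rcases lt_trichotomy n m with h | h | h
      · have := hclosed (n + 1) m (by omega) hn
        exact absurd (hw.symm.trans this) (by simp)
      · exact h
      · have := hclosed (m + 1) n (by omega) hm
        exact absurd (hu.symm.trans this) (by simp)
    subst hnm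
    obtain rfl : u = w := Option.some_injective _ (hu.symm.trans hw)
    exact hdisj u hw' hu'
  · exact hinf' _ hn
  · exact hinf _ hm
  · have := hcm c' hc'
    have := hcm' c hc
    omega

variable {V : Type} {E : V → V → Prop} {χ : V → ℕ} {P W : Set V} {par : ℕ} {σ : V → V}

/-- The largest color occurring infinitely often along a path of a winning certificate has the
right parity. -/
lemma WinCert.exists_limsup [Finite V] (h : WinCert E χ Set.univ P par W σ) {u : ℕ → V}
    (hu : ∀ n, StratMove E P W σ (u n) (u (n + 1))) :
    ∃ c, c % 2 = par ∧ (∀ N, ∃ n ≥ N, χ (u n) = c) ∧ ∃ N, ∀ n ≥ N, χ (u n) ≤ c := by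
  obtain ⟨B, hB⟩ := (Set.finite_range χ).bddAbove
  obtain ⟨c, hc, N, hN⟩ := exists_limsup_of_bounded (f := fun n => χ (u n)) fun n => hB ⟨_, rfl⟩
  refine ⟨c, ?_, hc, N, hN⟩
  by_contra hpar
  have hinf : {n | N ≤ n ∧ χ (u n) = c}.Infinite := by
    refine Set.infinite_of_forall_exists_gt fun M => ?_
    obtain ⟨n, hn, hnc⟩ := hc (max N (M + 1))
    exact ⟨n, ⟨le_of_max_le_left hn, hnc⟩, le_of_max_le_right hn⟩
  have key : ∀ m n, N ≤ m → m < n → χ (u m) = c → u m = u n → False := by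
    intro m n hm hmn hmc huv
    refine h.acyc (u m) (by rwa [hmc]) ?_
    have : ∀ n, m < n → TransGen (fun a b => StratMove E P W σ a b ∧ χ a ≤ χ (u m) ∧
        χ b ≤ χ (u m)) (u m) (u n) := by
      intro n hn
      rw [hmc]
      induction n, hn using Nat.le_induction with
      | base => exact TransGen.single ⟨hu m, hN m hm, hN _ (by omega)⟩
      | succ n hn ih => exact ih.tail ⟨hu n, hN n (by omega), hN _ (by omega)⟩
    have := this n hmn
    rwa [← huv] at this
  obtain ⟨m, hm, n, hn, hne, heq⟩ := hinf.exists_ne_map_eq_of_mapsTo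
    (f := u) (t := Set.univ) (fun _ _ => Set.mem_univ _) Set.finite_univ
  rcases lt_or_gt_of_ne hne with h1 | h1
  · exact key m n hm.1 h1 hm.2 heq
  · exact key n m hn.1 h1 hn.2 heq.symm

lemma WinCert.winsAt [Finite V] (h : WinCert E χ Set.univ P par W σ) {Q : Set V}
    (hQ : ∀ u, u ∉ P → u ∈ Q) {C : Set (Play V E)} (hC : ∀ α ∈ C, α.IsMax) {v : V}
    (hv : v ∈ W) : WinsAt E P C (ParityWinSet E χ Q par) v := by
  classical
  let s : PStrategy E P :=
    { W := W
      σ := fun u => if u ∈ W ∧ u ∈ P then some (σ u) else none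
      dom := by
        intro u w huw
        split_ifs at huw with hu
        obtain rfl := Option.some_injective _ huw
        exact ⟨hu.1, hu.2, h.own u hu.1 hu.2⟩ }
  refine ⟨s, ?_, hv⟩
  rintro α hα ⟨u₀, hu₀, hu₀W⟩ hfol
  refine ⟨hC α hα, ?_⟩
  have hmove : ∀ k u w, α.f k = some u → α.f (k + 1) = some w → u ∈ W →
      StratMove E P W σ u w := by
    intro k u w hu hw huW
    have huw := α.step k u w hu hw
    have hσ : u ∈ P → w = σ u := by
      intro hP
      have := hfol k u (σ u) hu (if_pos ⟨huW, hP⟩) (by simp [hw])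
      exact Option.some_injective _ (hw.symm.trans this)
    refine ⟨huW, ?_, huw, hσ⟩
    by_cases hP : u ∈ P
    · rw [hσ hP]; exact (h.own u huW hP).2
    · exact h.opp u huW hP w (Set.mem_univ _) huw
  have hW : ∀ k u, α.f k = some u → u ∈ W := by
    intro k
    induction k with
    | zero =>
      intro u hu
      rwa [Option.some_injective _ (hu.symm.trans hu₀)]
    | succ k ih =>
      intro w hw
      rcases hu : α.f k with - | u
      · exact absurd (hw.symm.trans (α.closed k hu)) (by simp)
      · exact (hmove k u w hu hw (ih u hu)).2.1
  rcases hC α hα with hinf | ⟨n, u, hu, hn, hsink⟩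
  · have hp : ∀ k, ∃ u, α.f k = some u := fun k => Option.ne_none_iff_exists'.1 (hinf k)
    choose p hp using hp
    obtain ⟨c, hpar, hc, N, hN⟩ := h.exists_limsup
      fun n => hmove n _ _ (hp n) (hp (n + 1)) (hW n _ (hp n))
    refine Or.inr ⟨hinf, c, fun M => ?_, hpar, fun c' hc' => ?_⟩
    · obtain ⟨n, hn, hnc⟩ := hc M
      exact ⟨n, hn, _, hp n, hnc⟩
    · obtain ⟨k, hk, u, hu, rfl⟩ := hc' N
      rw [← Option.some_injective _ ((hp k).symm.trans hu)]
      exact hN k hk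
  · exact Or.inl ⟨n, u, hu, hn, hQ u fun hP => hsink _ (h.own u (hW n u hu) hP).1⟩

/-- An infinite play of the register graph is an alternation of resets and transitions. -/
lemma exists_unfolding {r : ℕ} (α : Play _ (RE E χ r)) (hinf : ∀ k, α.f k ≠ none) :
    ∃ (N : ℕ) (u : ℕ → V) (x : ℕ → Fin r → ℕ) (j : ℕ → Fin r), ∀ n,
      α.f (N + 2 * n) = some (u n, x n, none) ∧
      α.f (N + 2 * n + 1) =
        some (u n, resetReg (x n) (j n), some (resetColor (x n) (j n))) ∧
      E (u n) (u (n + 1)) ∧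
      x (n + 1) = fun i => max (χ (u (n + 1))) (resetReg (x n) (j n) i) := by
  have hp : ∀ k, ∃ u, α.f k = some u := fun k => Option.ne_none_iff_exists'.1 (hinf k)
  choose p hp using hp
  have hstep : ∀ k, RE E χ r (p k) (p (k + 1)) := fun k => α.step k _ _ (hp k) (hp _)
  have hreset : ∀ k, (p k).2.2 = none → ∃ j : Fin r, p (k + 1) =
      ((p k).1, resetReg (p k).2.1 j, some (resetColor (p k).2.1 j)) := by
    intro k hk
    rcases hstep k with ⟨j, -, hj⟩ | ⟨c, hc, -⟩
    · exact ⟨j, hj⟩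
    · rw [hk] at hc; exact absurd hc (by simp)
  have htrans : ∀ k, (p k).2.2 ≠ none → (p (k + 1)).2.2 = none ∧ E (p k).1 (p (k + 1)).1 ∧
      (p (k + 1)).2.1 = fun i => max (χ (p (k + 1)).1) ((p k).2.1 i) := by
    intro k hk
    rcases hstep k with ⟨j, hj, -⟩ | ⟨c, -, hc⟩
    · exact absurd hj hk
    · exact hc
  obtain ⟨N, hN⟩ : ∃ N, (p N).2.2 = none := by
    by_cases h0 : (p 0).2.2 = none
    · exact ⟨0, h0⟩
    · exact ⟨1, (htrans 0 h0).1⟩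
  have hnone : ∀ n, (p (N + 2 * n)).2.2 = none := by
    intro n
    induction n with
    | zero => exact hN
    | succ n ih =>
      obtain ⟨j, hj⟩ := hreset _ ih
      exact (htrans (N + 2 * n + 1) (by rw [hj]; simp)).1
  choose j hj using fun n => hreset _ (hnone n)
  refine ⟨N, fun n => (p (N + 2 * n)).1, fun n => (p (N + 2 * n)).2.1, j, fun n => ?_⟩
  have h1 := htrans (N + 2 * n + 1) (by rw [hj]; simp)
  rw [hj n] at h1
  refine ⟨?_, ?_, h1.2.1, h1.2.2⟩
  · rw [hp, ← hnone n]
  · rw [hp, hj n]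

/-- Transfer of a win to the register game: besides the moves of a winning certificate, the player
may prescribe resets by `g`. -/
lemma WinCert.winsAt_register (h : WinCert E χ Set.univ P par W σ) {r : ℕ}
    (hr : 1 ≤ r) {OS OP : Set (V × (Fin r → ℕ) × Option ℕ)}
    (hOS : ∀ u y c, u ∈ P → (u, y, some c) ∈ OS) (hOP : ∀ u y c, u ∉ P → (u, y, some c) ∈ OP)
    (g : V → (Fin r → ℕ) → Option (Fin r)) (hg : ∀ u y, g u y ≠ none → (u, y, none) ∈ OS)
    (hwin : ∀ (u : ℕ → V) (x : ℕ → Fin r → ℕ) (j : ℕ → Fin r),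
      (∀ n, StratMove E P W σ (u n) (u (n + 1))) →
      (∀ n, x (n + 1) = fun i => max (χ (u (n + 1))) (resetReg (x n) (j n) i)) →
      (∀ n i, g (u n) (x n) = some i → j n = i) →
      ∃ c, c % 2 = par ∧ (∀ N, ∃ n ≥ N, resetColor (x n) (j n) = c) ∧
        ∃ N, ∀ n ≥ N, resetColor (x n) (j n) ≤ c)
    {C : Set (Play _ (RE E χ r))} (hC : ∀ α ∈ C, α.IsMax) {v : V} (hv : v ∈ W)
    (x : Fin r → ℕ) :
    WinsAt (RE E χ r) OS C (ParityWinSet (RE E χ r) rcol OP par) (v, x, none) := by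
  classical
  let s : PStrategy (RE E χ r) OS :=
    { W := {p | p.1 ∈ W}
      σ := fun p => if p.1 ∈ W then
          match p.2.2 with
          | none => (g p.1 p.2.1).map fun i =>
              (p.1, resetReg p.2.1 i, some (resetColor p.2.1 i))
          | some _ => if p.1 ∈ P then
              some (σ p.1, fun i => max (χ (σ p.1)) (p.2.1 i), none) else none
        else none
      dom := by
        rintro ⟨u, y, o⟩ q hq
        by_cases hu : u ∈ W
        swap
        · simp [hu] at hq
        rcases o with - | c
        · simp only [hu, if_true, Option.map_eq_some_iff] at hq
          obtain ⟨i, hi, rfl⟩ := hq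
          exact ⟨hu, hg u y (by simp [hi]), Or.inl ⟨i, rfl, rfl⟩, hu⟩
        · by_cases hP : u ∈ P
          · simp only [hu, hP, if_true, Option.some_inj] at hq
            subst hq
            have := h.own u hu hP
            exact ⟨hu, hOS u y c hP, Or.inr ⟨c, rfl, rfl, this.1, rfl⟩, this.2⟩
          · simp [hu, hP] at hq }
  have hs_none : ∀ u y i, u ∈ W → g u y = some i →
      s.σ (u, y, none) = some (u, resetReg y i, some (resetColor y i)) := by
    intro u y i hu hi
    simp [s, hu, hi]
  have hs_some : ∀ u y c, u ∈ W → u ∈ P →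
      s.σ (u, y, some c) = some (σ u, fun i => max (χ (σ u)) (y i), none) := by
    intro u y c hu hP
    simp [s, hu, hP]
  refine ⟨s, ?_, hv⟩
  rintro α hα ⟨p₀, hp₀, hp₀W⟩ hfol
  refine ⟨hC α hα, ?_⟩
  have hmove : ∀ k u y c q, α.f k = some (u, y, some c) → α.f (k + 1) = some q → u ∈ W →
      StratMove E P W σ u q.1 := by
    intro k u y c q hu hq huW
    have huq : E u q.1 := by
      rcases α.step k _ _ hu hq with ⟨_, hn, -⟩ | ⟨_, -, -, he, -⟩
      · simp at hn
      · exact he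
    have hσ : u ∈ P → q.1 = σ u := by
      intro hP
      have := hfol k _ _ hu (hs_some u y c huW hP) (by simp [hq])
      rw [Option.some_injective _ (hq.symm.trans this)]
    refine ⟨huW, ?_, huq, hσ⟩
    by_cases hP : u ∈ P
    · rw [hσ hP]; exact (h.own u huW hP).2
    · exact h.opp u huW hP _ (Set.mem_univ _) huq
  have hW : ∀ k p, α.f k = some p → p.1 ∈ W := by
    intro k
    induction k with
    | zero =>
      intro p hp
      rw [Option.some_injective _ (hp.symm.trans hp₀)]
      exact hp₀W
    | succ k ih =>
      intro q hq
      rcases hu : α.f k with - | ⟨u, y, o⟩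
      · exact absurd (hq.symm.trans (α.closed k hu)) (by simp)
      · have huW := ih _ hu
        rcases o with - | c
        · rcases α.step k _ _ hu hq with ⟨_, -, rfl⟩ | ⟨_, hn, -⟩
          · exact huW
          · simp at hn
        · exact (hmove k u y c q hu hq huW).2.1
  rcases hC α hα with hinf | ⟨n, ⟨u, y, o⟩, hu, hn, hsink⟩
  · obtain ⟨N, u, X, j, hun⟩ := exists_unfolding α hinf
    have hfoll : ∀ n i, g (u n) (X n) = some i → j n = i := by
      intro n i hi
      have := hfol _ _ _ (hun n).1 (hs_none _ _ i (hW _ _ (hun n).1) hi) (hinf _)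
      rw [(hun n).2.1] at this
      have h2 := congrArg (fun o : Option (V × (Fin r → ℕ) × Option ℕ) =>
        o.map fun p => p.2.2) this
      simp only [Option.map_some, Option.some_inj] at h2
      unfold resetColor at h2
      apply Fin.ext
      split_ifs at h2 <;> omega
    obtain ⟨c, hpar, hc, M, hM⟩ := hwin u X j
      (fun n => hmove _ _ _ _ _ (hun n).2.1
        (show α.f (N + 2 * n + 1 + 1) = _ from (hun (n + 1)).1) (hW _ _ (hun n).1))
      (fun n => (hun n).2.2.2) hfoll
    refine Or.inr ⟨hinf, c, fun K => ?_, hpar, fun c' hc' => ?_⟩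
    · obtain ⟨n, hn, hnc⟩ := hc K
      exact ⟨N + 2 * n + 1, by omega, _, (hun n).2.1, hnc⟩
    · obtain ⟨k, hk, p, hp, rfl⟩ := hc' (N + 2 * M)
      obtain ⟨n, hn, hkn⟩ : ∃ n ≥ M, k = N + 2 * n ∨ k = N + 2 * n + 1 :=
        ⟨(k - N) / 2, by omega, by omega⟩
      rcases hkn with rfl | rfl
      · rw [← Option.some_injective _ ((hun n).1.symm.trans hp)]
        exact Nat.zero_le _
      · rw [← Option.some_injective _ ((hun n).2.1.symm.trans hp)]
        exact hM n hn
  · refine Or.inl ⟨n, _, hu, hn, ?_⟩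
    rcases o with - | c
    · exact absurd (Or.inl ⟨⟨0, hr⟩, rfl, rfl⟩) (hsink _)
    · refine hOP u y c fun hP => ?_
      exact hsink (σ u, fun i => max (χ (σ u)) (y i), none)
        (Or.inr ⟨c, rfl, rfl, (h.own u (hW n _ hu) hP).1, rfl⟩)

/-- Register contents padded by zeros. -/
def padReg {r : ℕ} (y : Fin r → ℕ) (k : ℕ) : ℕ := if h : k < r then y ⟨k, h⟩ else 0

lemma padReg_of_lt {r k : ℕ} (y : Fin r → ℕ) (h : k < r) : padReg y k = y ⟨k, h⟩ := dif_pos h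

lemma resetReg_eq_shiftReset {r : ℕ} (y : Fin r → ℕ) (j k : Fin r) :
    resetReg y j k = shiftReset j (padReg y) k := by
  unfold resetReg shiftReset
  split_ifs
  · rfl
  · rw [padReg_of_lt]
  · rw [padReg_of_lt _ k.isLt]

/-- Even transfers a win to the register game with sufficiently many registers. -/
lemma WinCert.winsAt_register_even [Fintype V] (h : WinCert E χ Set.univ P 0 W σ) {r : ℕ}
    (hr : 1 ≤ r) (hcard : Fintype.card V < 2 ^ r)
    {OS OP : Set (V × (Fin r → ℕ) × Option ℕ)}
    (hOS : ∀ u y c, u ∈ P → (u, y, some c) ∈ OS) (hOS' : ∀ u y, (u, y, none) ∈ OS)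
    (hOP : ∀ u y c, u ∉ P → (u, y, some c) ∈ OP)
    {C : Set (Play _ (RE E χ r))} (hC : ∀ α ∈ C, α.IsMax) {v : V} (hv : v ∈ W)
    (x : Fin r → ℕ) :
    WinsAt (RE E χ r) OS C (ParityWinSet (RE E χ r) rcol OP 0) (v, x, none) := by
  classical
  obtain ⟨B, hB⟩ := (Set.finite_range χ).bddAbove
  obtain ⟨ρ, Inv, hρ⟩ := exists_defensiveOn (H := StratMove E P W σ) (χ := χ)
    (fun o ho => h.acyc o (by omega)) B r Finset.univ hcard
    fun u _ => (hB ⟨u, rfl⟩).trans (by omega)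
  refine h.winsAt_register hr hOS hOP
    (fun u y => some ⟨ρ u (padReg y), hρ.lt u (Finset.mem_univ _) _⟩) (fun u y _ => hOS' u y)
    ?_ hC hv x
  intro u X j hu hX hj
  have hj' : ∀ n, (j n : ℕ) = ρ (u n) (padReg (X n)) := fun n => by rw [hj n _ rfl]
  obtain ⟨i, hi, hinf, N, hN⟩ := hρ.win u (fun n => padReg (X n)) (fun _ => Finset.mem_univ _) hu
    (by
      intro n k hk
      rw [padReg_of_lt _ hk, hX n, ← hj' n]
      exact congrArg (max _) (resetReg_eq_shiftReset _ _ _))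
  have hcol : ∀ n ≥ N, (j n : ℕ) = i → resetColor (X n) (j n) = 2 * (i + 1) := by
    intro n hn hji
    have := (hN n hn).2 ((hj' n).symm.trans hji)
    rw [padReg_of_lt _ hi, show (⟨i, hi⟩ : Fin r) = j n from Fin.ext hji.symm] at this
    rw [resetColor, if_pos this, hji]
  refine ⟨2 * (i + 1), by omega, fun M => ?_, N, fun n hn => ?_⟩
  · obtain ⟨n, hn, hni⟩ := hinf (max M N)
    exact ⟨n, le_of_max_le_left hn,
      hcol n (le_of_max_le_right hn) ((hj' n).trans hni)⟩
  · by_cases hji : (j n : ℕ) = i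
    · exact (hcol n hn hji).le
    · have := (hN n hn).1
      rw [← hj' n] at this
      unfold resetColor
      split_ifs <;> omega

/-- Odd transfers a win to the register game. -/
lemma WinCert.winsAt_register_odd [Finite V] (h : WinCert E χ Set.univ P 1 W σ) {r : ℕ}
    (hr : 1 ≤ r) {OS OP : Set (V × (Fin r → ℕ) × Option ℕ)}
    (hOS : ∀ u y c, u ∈ P → (u, y, some c) ∈ OS) (hOP : ∀ u y c, u ∉ P → (u, y, some c) ∈ OP)
    {C : Set (Play _ (RE E χ r))} (hC : ∀ α ∈ C, α.IsMax) {v : V} (hv : v ∈ W)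
    (x : Fin r → ℕ) :
    WinsAt (RE E χ r) OS C (ParityWinSet (RE E χ r) rcol OP 1) (v, x, none) := by
  refine h.winsAt_register hr hOS hOP (fun _ _ => none) (fun _ _ h => absurd rfl h) ?_ hC hv x
  intro u X j hu hX _
  obtain ⟨c, hc, hcinf, N₁, hN₁⟩ := h.exists_limsup hu
  obtain ⟨i, hiinf, N₂, hN₂⟩ := exists_limsup_of_bounded (f := fun n => (j n : ℕ)) (B := r)
    fun n => (j n).isLt.le
  have hi : i < r := by
    obtain ⟨n, -, hn⟩ := hiinf 0
    exact hn ▸ (j n).isLt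
  have hX' : ∀ n k (hk : k < r), X (n + 1) ⟨k, hk⟩ =
      max (χ (u (n + 1))) (shiftReset (j n) (padReg (X n)) k) := by
    intro n k hk
    rw [hX n]
    exact congrArg (max _) (resetReg_eq_shiftReset _ _ _)
  -- eventually all relevant registers hold at most `c`
  have hle : ∀ k ≤ i + 1, ∃ N ≥ max N₁ N₂, ∀ n ≥ N, ∀ l < k, padReg (X n) l ≤ c := by
    intro k
    induction k with
    | zero => exact fun _ => ⟨max N₁ N₂, le_rfl, by simp⟩
    | succ k ih =>
      intro hk
      obtain ⟨N, hN, hNk⟩ := ih (by omega)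
      obtain ⟨m, hm, hmi⟩ := hiinf N
      have hstep : ∀ n ≥ N, (padReg (X n) k ≤ c ∨ (j n : ℕ) = i) →
          padReg (X (n + 1)) k ≤ c := by
        intro n hn hor
        rw [padReg_of_lt _ (show k < r by omega), hX' n k (by omega)]
        refine max_le (hN₁ _ (by have := le_of_max_le_left hN; omega)) ?_
        unfold shiftReset
        split_ifs with h1 h2
        · omega
        · exact hNk n hn _ (by omega)
        · exact hor.resolve_right (by omega)
      refine ⟨m + 1, by omega, fun n hn l hl => ?_⟩
      rcases Nat.lt_succ_iff_lt_or_eq.1 hl with h1 | rfl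
      · exact hNk n (by omega) l h1
      · induction n, hn using Nat.le_induction with
        | base => exact hstep m hm (Or.inr hmi)
        | succ n hn ih' => exact hstep n (by omega) (Or.inl ih')
  obtain ⟨N, hN, hNle⟩ := hle (i + 1) le_rfl
  have hN1 := le_of_max_le_left hN
  have hN2 := le_of_max_le_right hN
  refine ⟨2 * (i + 1) + 1, by omega, fun M => ?_, N, fun n hn => ?_⟩
  · obtain ⟨m, hm, hmc⟩ := hcinf (max M N + 1)
    have hm1 := le_max_left M N
    have hm2 := le_max_right M N
    have hex : ∃ t, m ≤ t ∧ (j t : ℕ) = i := by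
      obtain ⟨t, ht⟩ := hiinf m
      exact ⟨t, ht⟩
    obtain ⟨ht, hti⟩ := Nat.find_spec hex
    have hge : ∀ t ≥ m, t ≤ Nat.find hex → c ≤ padReg (X t) i := by
      intro t ht
      induction t, ht using Nat.le_induction with
      | base =>
        intro _
        obtain ⟨p, rfl⟩ : ∃ p, m = p + 1 := ⟨m - 1, by omega⟩
        rw [padReg_of_lt _ hi, hX' p i hi, hmc]
        exact le_max_left _ _
      | succ t ht' ih =>
        intro hle'
        have h1 : (j t : ℕ) ≠ i := fun hji => Nat.find_min hex (m := t) (by omega) ⟨ht', hji⟩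
        have h2 := hN₂ t (by omega)
        rw [padReg_of_lt _ hi, hX' t i hi, shiftReset_of_lt (by omega)]
        exact (ih (by omega)).trans (le_max_right _ _)
    generalize Nat.find hex = t at *
    have hval : X t (j t) = c := by
      have h1 := hge t ht le_rfl
      have h2 := hNle t (by omega) i (by omega)
      rw [padReg_of_lt _ hi, show (⟨i, hi⟩ : Fin r) = j t from Fin.ext hti.symm] at h1 h2
      omega
    refine ⟨t, by omega, ?_⟩
    rw [resetColor, hval, if_neg (by omega), hti]
  · have := hN₂ n (by omega)
    unfold resetColor
    split_ifs <;> omega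

end Plays

/-- If Even wins the parity game `(G,v)` and `|V| < 2^r`, then Even wins the
`r`-register game `R^r(G,v,x)` for every initial register content `x`;
consequently (with the converse direction for Odd), for `|V| < 2^r` the games
`(G,v)` and `R^r(G,v,x)` have the same winner. -/
theorem stmt18 {V : Type} [Fintype V] (E : V → V → Prop) (V0 V1 : Set V)
    (hcov : ∀ v, v ∈ V0 ∨ v ∈ V1) (hdisj : V0 ∩ V1 = ∅)
    (χ : V → ℕ) (r : ℕ) (hr : 1 ≤ r) (hcard : Fintype.card V < 2 ^ r)
    (v : V) (x : Fin r → ℕ) (hx : Monotone x) :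
    (WinsAt E V0 (ParityWinSet E χ V1 0 ∪ ParityWinSet E χ V0 1)
        (ParityWinSet E χ V1 0) v →
      WinsAt (RE E χ r) (REvenStates V0 r)
        (ParityWinSet (RE E χ r) rcol (ROddStates V1 r) 0 ∪
          ParityWinSet (RE E χ r) rcol (REvenStates V0 r) 1)
        (ParityWinSet (RE E χ r) rcol (ROddStates V1 r) 0)
        (v, x, none)) ∧
    (WinsAt E V0 (ParityWinSet E χ V1 0 ∪ ParityWinSet E χ V0 1)
        (ParityWinSet E χ V1 0) v ↔
      WinsAt (RE E χ r) (REvenStates V0 r)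
        (ParityWinSet (RE E χ r) rcol (ROddStates V1 r) 0 ∪
          ParityWinSet (RE E χ r) rcol (REvenStates V0 r) 1)
        (ParityWinSet (RE E χ r) rcol (ROddStates V1 r) 0)
        (v, x, none)) ∧
    (WinsAt E V1 (ParityWinSet E χ V1 0 ∪ ParityWinSet E χ V0 1)
        (ParityWinSet E χ V0 1) v ↔
      WinsAt (RE E χ r) (ROddStates V1 r)
        (ParityWinSet (RE E χ r) rcol (ROddStates V1 r) 0 ∪
          ParityWinSet (RE E χ r) rcol (REvenStates V0 r) 1)
        (ParityWinSet (RE E χ r) rcol (REvenStates V0 r) 1)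
        (v, x, none)) := by
  classical
  obtain rfl : V1 = V0ᶜ := by
    ext u
    refine ⟨fun h h' => ?_, fun h => (hcov u).resolve_left h⟩
    have : u ∈ V0 ∩ V1 := ⟨h', h⟩
    rw [hdisj] at this
    exact this
  have hCG : ∀ α ∈ ParityWinSet E χ V0ᶜ 0 ∪ ParityWinSet E χ V0 1, α.IsMax :=
    fun α hα => hα.elim And.left And.left
  have hCR : ∀ α ∈ ParityWinSet (RE E χ r) rcol (ROddStates V0ᶜ r) 0 ∪
      ParityWinSet (RE E χ r) rcol (REvenStates V0 r) 1, α.IsMax :=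
    fun α hα => hα.elim And.left And.left
  have hnotG := not_winsAt_both (E := E) (χ := χ) (Vi := V0) (Vj := V0ᶜ) (v := v)
    (B := Finset.univ.sup χ) hcov (fun u h h' => h' h)
    (fun _ b _ => Finset.le_sup (Finset.mem_univ b))
  have hnotR := not_winsAt_both (E := RE E χ r) (χ := rcol) (Vi := REvenStates V0 r)
    (Vj := ROddStates V0ᶜ r) (v := (v, x, none)) (B := 2 * r + 1)
    (fun p => by
      by_cases h1 : p.2.2 = none
      · exact Or.inl (Or.inl h1)
      · by_cases h2 : p.1 ∈ V0
        · exact Or.inl (Or.inr h2)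
        · exact Or.inr ⟨h1, h2⟩)
    (fun p h h' => h.elim h'.1 h'.2)
    (by
      rintro p q (⟨j, -, rfl⟩ | ⟨c, -, hq, -⟩)
      · have := j.isLt
        simp only [rcol, Option.getD_some, resetColor]
        split_ifs <;> omega
      · simp [rcol, hq])
  rcases exists_winCert E χ V0 Set.univ v (Set.mem_univ v) with ⟨W, σ, h, hv⟩ | ⟨W, σ, h, hv⟩
  · have hG := h.winsAt (Q := V0ᶜ) (fun u hu => hu) hCG hv
    have hR := h.winsAt_register_even hr hcard (OS := REvenStates V0 r)
      (OP := ROddStates V0ᶜ r) (fun u y c hu => Or.inr hu) (fun u y => Or.inl rfl)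
      (fun u y c hu => ⟨by simp, hu⟩) hCR hv x
    exact ⟨fun _ => hR, iff_of_true hG hR, iff_of_false (hnotG hG) (hnotR hR)⟩
  · have hG := h.winsAt (Q := V0) (fun u hu => not_not.1 hu) hCG hv
    have hR := h.winsAt_register_odd hr (OS := ROddStates V0ᶜ r)
      (OP := REvenStates V0 r) (fun u y c hu => ⟨by simp, hu⟩)
      (fun u y c hu => Or.inr (not_not.1 hu)) hCR hv x
    have hG' := fun h' => hnotG h' hG
    exact ⟨fun h' => (hG' h').elim, iff_of_false hG' fun h' => hnotR h' hR, iff_of_true hG hR⟩
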